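/- arXiv:1607.06143 — 3 statements merged into one kernel-verified Lean document; each statement's English description precedes it below -/
import Mathlib

section
/- Let A be a random M×N matrix over F_q whose M·N entries are i.i.d. with distribution μ, and let x ∈ F_q^N be a fixed vector with exactly w ≥ 1 nonzero coordinates. Then the probability that Ax = 0 equals γ_w^M. -/
open Finset
open scoped Classical

noncomputable section

/-- The entry distribution μ on the finite field `F`: the value `0` has
probability `ε_SR` and each nonzero value has probability `(1-ε_SR)/(q-1)`,
where `q = |F|`. -/
def muDist (F : Type*) [Field F] [Fintype F] [DecidableEq F] (εSR : ℝ) (t : F) : ℝ :=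
  if t = 0 then εSR else (1 - εSR) / ((Fintype.card F : ℝ) - 1)

/-- The probability that a random `M × N` matrix over `F` with i.i.d.
`μ`-distributed entries equals the fixed matrix `A`. -/
def matProb (F : Type*) [Field F] [Fintype F] [DecidableEq F] (εSR : ℝ) {M N : ℕ}
    (A : Matrix (Fin M) (Fin N) F) : ℝ :=
  ∏ i, ∏ j, muDist F εSR (A i j)

/-- `γ_w = q⁻¹ + (1 - q⁻¹)·(1 - (1-ε_SR)/(1-q⁻¹))^w`. -/
def gammaW (q εSR : ℝ) (w : ℕ) : ℝ :=
  q⁻¹ + (1 - q⁻¹) * (1 - (1 - εSR) / (1 - q⁻¹)) ^ w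

/-- `μ` is a mixture of the uniform distribution and the point mass at `0`. -/
theorem muDist_eq_mixture (F : Type*) [Field F] [Fintype F] [DecidableEq F] (εSR : ℝ) (t : F) :
    muDist F εSR t =
      (1 - (1 - (1 - εSR) / (1 - (Fintype.card F : ℝ)⁻¹))) / (Fintype.card F : ℝ) +
        if t = 0 then 1 - (1 - εSR) / (1 - (Fintype.card F : ℝ)⁻¹) else 0 := by
  have hq : (1 : ℝ) < Fintype.card F := by exact_mod_cast Fintype.one_lt_card (α := F)
  have h0 : (Fintype.card F : ℝ) ≠ 0 := by positivity
  have h1 : (Fintype.card F : ℝ) - 1 ≠ 0 := sub_ne_zero.2 hq.ne'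
  have h2 : 1 - (Fintype.card F : ℝ)⁻¹ = ((Fintype.card F : ℝ) - 1) / Fintype.card F := by
    field_simp
  unfold muDist
  rw [h2]
  split_ifs
  · field_simp
    ring
  · field_simp
    ring

/-- A linear combination, with coefficients `x`, of independent variables distributed as a
mixture of the uniform distribution and the point mass at `0` is again such a mixture. -/
theorem sum_ite_dotProduct_mixture {F : Type*} [Field F] [Fintype F] [DecidableEq F]
    (l : ℝ) (p : F → ℝ) (hp : ∀ t, p t = (1 - l) / Fintype.card F + if t = 0 then l else 0)
    {n : ℕ} (x : Fin n → F) (c : F) :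
    (∑ a : Fin n → F, if ∑ j, a j * x j = c then ∏ j, p (a j) else 0) =
      (1 - ∏ j, if x j ≠ 0 then l else 1) / Fintype.card F +
        if c = 0 then ∏ j, (if x j ≠ 0 then l else 1) else 0 := by
  have h0 : (Fintype.card F : ℝ) ≠ 0 := by exact_mod_cast Fintype.card_ne_zero
  have mixture_sum (k : ℝ) :
      ∑ t : F, ((1 - k) / (Fintype.card F : ℝ) + if t = 0 then k else 0) = 1 := by
    rw [sum_add_distrib, sum_const, card_univ, nsmul_eq_mul, sum_ite_eq' univ (0 : F),
      if_pos (mem_univ _)]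
    field_simp
    ring
  induction n generalizing c with
  | zero => simp [eq_comm]
  | succ n ih =>
    have step : (∑ a : Fin (n + 1) → F, if ∑ j, a j * x j = c then ∏ j, p (a j) else 0) =
        ∑ t : F, p t * ∑ a : Fin n → F,
          if ∑ j, a j * x j.succ = c - t * x 0 then ∏ j, p (a j) else 0 := by
      rw [← (Fin.consEquiv fun _ => F).sum_comp, Fintype.sum_prod_type]
      refine sum_congr rfl fun t _ => ?_
      rw [mul_sum]
      refine sum_congr rfl fun a _ => ?_
      simp [Fin.sum_univ_succ, Fin.prod_univ_succ, Fin.consEquiv, eq_sub_iff_add_eq', mul_ite]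
    rw [step]
    simp_rw [ih fun j => x j.succ]
    rw [Fin.prod_univ_succ]
    generalize (∏ j : Fin n, if x j.succ ≠ 0 then l else 1) = L
    by_cases hx : x 0 = 0
    · simp only [hx, mul_zero, sub_zero, ← sum_mul, ne_eq, not_true_eq_false, if_false, one_mul]
      simp_rw [hp]
      rw [mixture_sum, one_mul]
    · have shift : ∑ t : F, ((1 - L) / (Fintype.card F : ℝ) +
          if c - t * x 0 = 0 then L else 0) = 1 := by
        refine Eq.trans ?_ (mixture_sum L)
        exact ((Equiv.mulRight₀ (x 0) hx).trans (Equiv.subLeft c)).sum_comp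
          fun t => (1 - L) / (Fintype.card F : ℝ) + if t = 0 then L else 0
      simp_rw [hp, add_mul]
      rw [sum_add_distrib, ← mul_sum, shift]
      simp only [ite_mul, zero_mul, sum_ite_eq', mem_univ, if_true, sub_zero, ne_eq, hx,
        not_false_eq_true]
      split_ifs <;> field_simp <;> ring

/-- if `A` is a random `M × N` matrix over `F_q` whose `M·N` entries are
i.i.d. `μ`-distributed and `x ∈ F_q^N` is a fixed vector with exactly `w ≥ 1` nonzero
coordinates, then the probability that `Ax = 0` equals `γ_w^M`. -/
theorem stmt_3 (F : Type*) [Field F] [Fintype F] [DecidableEq F]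
    (hq : 2 ≤ Fintype.card F)
    (εSR : ℝ) (hεSR : εSR ∈ Set.Icc (0 : ℝ) 1)
    (M N : ℕ) (hM : 0 < M) (hN : 0 < N)
    (x : Fin N → F) (w : ℕ) (hw : 1 ≤ w)
    (hx : (univ.filter fun j => x j ≠ 0).card = w) :
    (∑ A : Matrix (Fin M) (Fin N) F,
        if A.mulVec x = 0 then matProb F εSR A else 0) =
      gammaW (Fintype.card F : ℝ) εSR w ^ M := by
  have row := sum_ite_dotProduct_mixture _ _ (muDist_eq_mixture F εSR) x 0
  rw [if_pos rfl, prod_ite, prod_const, prod_const_one, mul_one, hx] at row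
  have row_gamma : (∑ a : Fin N → F,
      if ∑ j, a j * x j = 0 then ∏ j, muDist F εSR (a j) else 0) =
        gammaW (Fintype.card F : ℝ) εSR w := by
    rw [row, gammaW]
    ring
  calc
    _ = ∑ A : Fin M → Fin N → F, ∏ i,
        if ∑ j, A i j * x j = 0 then ∏ j, muDist F εSR (A i j) else 0 := by
      refine sum_congr rfl fun A _ => ?_
      rw [prod_ite_zero]
      simp [funext_iff, Matrix.mulVec, dotProduct, matProb]
    _ = ∏ _i : Fin M, ∑ a : Fin N → F,
        if ∑ j, a j * x j = 0 then ∏ j, muDist F εSR (a j) else 0 := by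
      rw [prod_univ_sum, Fintype.piFinset_univ]
    _ = _ := by simp [row_gamma]
end
end

section
/- Let A be a random M×N matrix over F_q drawn from the row-erasure model, and let x ∈ F_q^N be a fixed vector with exactly w ≥ 1 nonzero coordinates. Then the probability that Ax = 0 equals [ε_RD + (1−ε_RD)·γ_w]^M. -/
open Finset
open scoped Classical

noncomputable section

/-- Row distribution of the row-erasure model: a row is the zero row with
probability `ε_RD`, and otherwise consists of `N` i.i.d. `μ`-distributed entries. -/
def reRowProb (F : Type*) [Field F] [Fintype F] [DecidableEq F] (εSR εRD : ℝ) {N : ℕ}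
    (v : Fin N → F) : ℝ :=
  (if v = 0 then εRD else 0) + (1 - εRD) * ∏ j, muDist F εSR (v j)

/-- The probability that a random `M × N` matrix drawn from the row-erasure model
(independent rows, each distributed as `reRowProb`) equals the fixed matrix `A`. -/
def reMatProb (F : Type*) [Field F] [Fintype F] [DecidableEq F] (εSR εRD : ℝ) {M N : ℕ}
    (A : Matrix (Fin M) (Fin N) F) : ℝ :=
  ∏ i, reRowProb F εSR εRD (A i)

/-- The distribution `muDist` has total mass one. -/
theorem sum_muDist (F : Type*) [Field F] [Fintype F] [DecidableEq F] (ε : ℝ) :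
    ∑ t : F, muDist F ε t = 1 := by
  have hq : (1 : ℝ) < Fintype.card F := by exact_mod_cast Fintype.one_lt_card (α := F)
  have hq' : (Fintype.card F : ℝ) - 1 ≠ 0 := by linarith
  have h : ∀ t : F, muDist F ε t =
      (1 - ε) / ((Fintype.card F : ℝ) - 1) +
        if t = 0 then ε - (1 - ε) / ((Fintype.card F : ℝ) - 1) else 0 := by
    intro t
    unfold muDist
    split_ifs <;> ring
  simp only [h, sum_add_distrib, sum_ite_eq', mem_univ, if_true, sum_const, card_univ,
    nsmul_eq_mul]
  field_simp
  ring

/-- Deviation of `muDist` from the uniform distribution. -/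
theorem muDist_eq (F : Type*) [Field F] [Fintype F] [DecidableEq F] (ε : ℝ) (t : F) :
    muDist F ε t = (Fintype.card F : ℝ)⁻¹ + ((if t = 0 then 1 else 0) - (Fintype.card F : ℝ)⁻¹) *
      (1 - (1 - ε) / (1 - (Fintype.card F : ℝ)⁻¹)) := by
  have hq : (1 : ℝ) < Fintype.card F := by exact_mod_cast Fintype.one_lt_card (α := F)
  have hq' : (Fintype.card F : ℝ) - 1 ≠ 0 := by linarith
  have hq0 : (Fintype.card F : ℝ) ≠ 0 := by linarith
  have h1 : 1 - (Fintype.card F : ℝ)⁻¹ = ((Fintype.card F : ℝ) - 1) / Fintype.card F := by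
    field_simp
  unfold muDist
  rw [h1]
  split_ifs
  · field_simp
    ring
  · field_simp
    ring

/-- The distribution of the linear form `v ↦ ∑ j, v j * x j` when the coordinates of `v` are
independent and distributed as `muDist`. -/
theorem sum_prod_muDist_of_sum_mul_eq (F : Type*) [Field F] [Fintype F] [DecidableEq F] (ε : ℝ)
    (N : ℕ) (x : Fin N → F) (t : F) :
    (∑ v : Fin N → F, if ∑ j, v j * x j = t then ∏ j, muDist F ε (v j) else 0) =
      (Fintype.card F : ℝ)⁻¹ + ((if t = 0 then 1 else 0) - (Fintype.card F : ℝ)⁻¹) *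
        ∏ j, if x j = 0 then 1 else 1 - (1 - ε) / (1 - (Fintype.card F : ℝ)⁻¹) := by
  induction N generalizing t with
  | zero => simp [eq_comm]
  | succ N ih =>
    rw [← (Fin.consEquiv fun _ : Fin (N + 1) => F).sum_comp, Fintype.sum_prod_type]
    have h : ∀ a : F, (∑ v : Fin N → F,
        if ∑ j, (Fin.consEquiv fun _ : Fin (N + 1) => F) (a, v) j * x j = t
        then ∏ j, muDist F ε ((Fin.consEquiv fun _ : Fin (N + 1) => F) (a, v) j) else 0) =
        muDist F ε a * ∑ v : Fin N → F,
          if ∑ j, v j * x j.succ = t - a * x 0 then ∏ j, muDist F ε (v j) else 0 := by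
      intro a
      rw [mul_sum]
      refine sum_congr rfl fun v _ => ?_
      simp [Fin.consEquiv, Fin.sum_univ_succ, Fin.prod_univ_succ, eq_sub_iff_add_eq']
    simp only [h, ih fun j => x j.succ]
    rw [Fin.prod_univ_succ]
    by_cases h0 : x 0 = 0
    · simp only [h0, mul_zero, sub_zero, if_true, one_mul]
      rw [← sum_mul, sum_muDist, one_mul]
    · generalize (∏ j : Fin N, if x j.succ = 0 then (1 : ℝ)
        else 1 - (1 - ε) / (1 - (Fintype.card F : ℝ)⁻¹)) = P
      have hsub : ∀ a : F, t - a * x 0 = 0 ↔ a = t / x 0 := fun a => by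
        rw [sub_eq_zero, eq_div_iff h0, eq_comm]
      have hsplit : ∀ a : F, muDist F ε a * ((Fintype.card F : ℝ)⁻¹ +
          ((if a = t / x 0 then 1 else 0) - (Fintype.card F : ℝ)⁻¹) * P) =
          muDist F ε a * ((Fintype.card F : ℝ)⁻¹ * (1 - P)) +
            if a = t / x 0 then muDist F ε a * P else 0 := by
        intro a
        split_ifs <;> ring
      simp only [hsub, hsplit, sum_add_distrib, sum_ite_eq', mem_univ, if_true]
      rw [← sum_mul, sum_muDist, muDist_eq]
      simp only [div_eq_zero_iff, h0, or_false, if_false]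
      ring

/-- if `A` is a random `M × N` matrix over `F_q` drawn from the
row-erasure model, and `x ∈ F_q^N` is a fixed vector with exactly `w ≥ 1` nonzero
coordinates, then the probability that `Ax = 0` equals `(ε_RD + (1-ε_RD)·γ_w)^M`. -/
theorem stmt_4 (F : Type*) [Field F] [Fintype F] [DecidableEq F]
    (hq : 2 ≤ Fintype.card F)
    (εSR : ℝ) (hεSR : εSR ∈ Set.Icc (0 : ℝ) 1)
    (εRD : ℝ) (hεRD : εRD ∈ Set.Icc (0 : ℝ) 1)
    (M N : ℕ) (hM : 0 < M) (hN : 0 < N)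
    (x : Fin N → F) (w : ℕ) (hw : 1 ≤ w)
    (hx : (univ.filter fun j => x j ≠ 0).card = w) :
    (∑ A : Matrix (Fin M) (Fin N) F,
        if A.mulVec x = 0 then reMatProb F εSR εRD A else 0) =
      (εRD + (1 - εRD) * gammaW (Fintype.card F : ℝ) εSR w) ^ M := by
  have hprod : (∏ j, if x j = 0 then (1 : ℝ)
      else 1 - (1 - εSR) / (1 - (Fintype.card F : ℝ)⁻¹)) =
      (1 - (1 - εSR) / (1 - (Fintype.card F : ℝ)⁻¹)) ^ w := by
    rw [← hx, ← prod_const, prod_filter]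
    refine prod_congr rfl fun j _ => ?_
    by_cases h : x j = 0 <;> simp [h]
  have hrow : (∑ v : Fin N → F, if ∑ j, v j * x j = 0 then reRowProb F εSR εRD v else 0) =
      εRD + (1 - εRD) * gammaW (Fintype.card F : ℝ) εSR w := by
    have hlin := sum_prod_muDist_of_sum_mul_eq F εSR N x 0
    rw [hprod, if_pos rfl] at hlin
    rw [gammaW, ← hlin, mul_sum]
    have hsplit : ∀ v : Fin N → F,
        (if ∑ j, v j * x j = 0 then reRowProb F εSR εRD v else 0) =
        (if v = 0 then εRD else 0) + (1 - εRD) *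
          if ∑ j, v j * x j = 0 then ∏ j, muDist F εSR (v j) else 0 := by
      intro v
      by_cases hv : v = 0
      · simp [reRowProb, hv]
      · by_cases hs : ∑ j, v j * x j = 0 <;> simp [reRowProb, hv, hs]
    simp only [hsplit, sum_add_distrib, sum_ite_eq', mem_univ, if_true]
  rw [← hrow, Fintype.sum_pow]
  refine sum_congr rfl fun A _ => ?_
  by_cases h : A.mulVec x = 0
  · have hA : ∀ i, ∑ j, A i j * x j = 0 := fun i => congrFun h i
    simp [h, hA, reMatProb]
  · obtain ⟨i, hi⟩ := Function.ne_iff.mp h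
    rw [if_neg h]
    exact (prod_eq_zero (mem_univ i) (if_neg hi)).symm
end
end

section
/- (Corollary, eq. (6)) Let A be a random M×N matrix over F_q drawn from the row-erasure model, with M ≥ N ≥ 1. Then the probability of decoding failure P_fail := Pr(rank(A) < N) satisfies P_fail ≤ (1/(q−1))·Σ_{w=1}^{N} C(N,w)·(q−1)^w·[ε_RD + (1−ε_RD)·γ_w]^M. -/
open Finset
open scoped Classical

noncomputable section

/-- The mixture of the uniform distribution (weight `1 - a`) and the point mass at `0`
(weight `a`) on the finite field `F`. -/
def zeroMixture (F : Type*) [Field F] [Fintype F] [DecidableEq F] (a : ℝ) (t : F) : ℝ :=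
  (Fintype.card F : ℝ)⁻¹ + ((if t = 0 then 1 else 0) - (Fintype.card F : ℝ)⁻¹) * a

lemma one_lt_card_real {F : Type*} [Field F] [Fintype F] : (1 : ℝ) < Fintype.card F := by
  exact_mod_cast Fintype.one_lt_card (α := F)

section

variable {F : Type*} [Field F] [Fintype F] [DecidableEq F]

lemma muDist_eq_zeroMixture (εSR : ℝ) (t : F) :
    muDist F εSR t =
      zeroMixture F (1 - (1 - εSR) / (1 - (Fintype.card F : ℝ)⁻¹)) t := by
  have h := one_lt_card_real (F := F)
  have h0 : (Fintype.card F : ℝ) ≠ 0 := by positivity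
  have h1 : (Fintype.card F : ℝ) - 1 ≠ 0 := by linarith
  have h2 : 1 - (Fintype.card F : ℝ)⁻¹ = ((Fintype.card F : ℝ) - 1) / Fintype.card F := by
    field_simp
  unfold muDist zeroMixture
  rw [h2]
  split_ifs <;> field_simp <;> ring

lemma sum_zeroMixture (a : ℝ) : ∑ t : F, zeroMixture F a t = 1 := by
  have h0 : (Fintype.card F : ℝ) ≠ 0 := by exact_mod_cast Fintype.card_ne_zero
  simp [zeroMixture, sum_add_distrib, ← sum_mul, h0]

lemma sum_zeroMixture_comp (a : ℝ) (x t : F) (hx : x ≠ 0) :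
    ∑ s : F, zeroMixture F a (t - s * x) = 1 := by
  rw [← sum_zeroMixture (F := F) a]
  exact Fintype.sum_equiv ((Equiv.mulRight₀ x hx).trans (Equiv.subLeft t)) _ _ fun s => by simp

lemma zeroMixture_conv (a b : ℝ) (x t : F) (hx : x ≠ 0) :
    ∑ s : F, zeroMixture F b s * zeroMixture F a (t - s * x) = zeroMixture F (b * a) t := by
  have hsplit : ∀ s : F, zeroMixture F b s * zeroMixture F a (t - s * x) =
      (Fintype.card F : ℝ)⁻¹ * (1 - b) * zeroMixture F a (t - s * x) +
        (if s = 0 then b * zeroMixture F a t else 0) := by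
    intro s
    by_cases hs : s = 0
    · subst hs
      simp only [zeroMixture, if_true, zero_mul, sub_zero]
      ring
    · simp only [zeroMixture, hs, if_false]
      ring
  rw [sum_congr rfl fun s _ => hsplit s, sum_add_distrib, ← mul_sum, sum_zeroMixture_comp a x t hx,
    sum_ite_eq' univ (0 : F), if_pos (mem_univ _)]
  unfold zeroMixture
  ring

lemma sum_prod_zeroMixture (b : ℝ) {n : ℕ} (x : Fin n → F) (t : F) :
    ∑ v : Fin n → F, (∏ j, zeroMixture F b (v j)) * (if ∑ j, v j * x j = t then 1 else 0) =
      zeroMixture F (∏ j, if x j = 0 then 1 else b) t := by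
  induction n generalizing t with
  | zero => simp [zeroMixture, eq_comm]
  | succ n ih =>
    rw [← (Fin.consEquiv fun _ => F).sum_comp, Fintype.sum_prod_type]
    have hcond : ∀ (s c : F), s * x 0 + c = t ↔ c = t - s * x 0 := fun s c => by
      rw [eq_sub_iff_add_eq, add_comm]
    simp only [Fin.consEquiv_apply, Fin.prod_univ_succ, Fin.sum_univ_succ, Fin.cons_zero,
      Fin.cons_succ, hcond, mul_assoc]
    simp only [← mul_sum, ih]
    by_cases hx : x 0 = 0
    · simp [hx, ← sum_mul, sum_zeroMixture]
    · rw [zeroMixture_conv _ _ _ _ hx]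
      simp [hx]

lemma sum_reRowProb (εSR εRD : ℝ) {N : ℕ} (x : Fin N → F) :
    ∑ v : Fin N → F, reRowProb F εSR εRD v * (if v ⬝ᵥ x = 0 then 1 else 0) =
      εRD + (1 - εRD) * gammaW (Fintype.card F : ℝ) εSR (#{j | x j ≠ 0}) := by
  have hmu : ∑ v : Fin N → F, (∏ j, muDist F εSR (v j)) * (if v ⬝ᵥ x = 0 then 1 else 0) =
      zeroMixture F
        (∏ j, if x j = 0 then 1 else 1 - (1 - εSR) / (1 - (Fintype.card F : ℝ)⁻¹)) 0 := by
    simp only [muDist_eq_zeroMixture]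
    exact sum_prod_zeroMixture _ x 0
  have hprod : ∀ b : ℝ, (∏ j, if x j = 0 then 1 else b) = b ^ #{j | x j ≠ 0} := fun b => by
    rw [prod_ite, prod_const_one, one_mul, prod_const]
  simp only [reRowProb, add_mul, sum_add_distrib, mul_assoc, ← mul_sum]
  rw [hmu, hprod]
  congr 1
  · rw [sum_eq_single 0] <;> simp +contextual
  · simp [zeroMixture, gammaW]

lemma sum_reMatProb_mulVec_eq_zero (εSR εRD : ℝ) (M : ℕ) {N : ℕ} (x : Fin N → F) :
    ∑ A : Matrix (Fin M) (Fin N) F, reMatProb F εSR εRD A * (if A.mulVec x = 0 then 1 else 0) =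
      (εRD + (1 - εRD) * gammaW (Fintype.card F : ℝ) εSR (#{j | x j ≠ 0})) ^ M := by
  rw [← sum_reRowProb]
  have hpow := (Fintype.sum_pow
    (fun v : Fin N → F => reRowProb F εSR εRD v * (if v ⬝ᵥ x = 0 then (1 : ℝ) else 0)) M)
  rw [hpow]
  refine Fintype.sum_congr _ _ fun A => ?_
  rw [prod_mul_distrib, prod_ite_zero, prod_const_one, reMatProb]
  simp [funext_iff, Matrix.mulVec]

lemma sum_ne_zero_weight (f : ℕ → ℝ) (N : ℕ) :
    ∑ x : Fin N → F with x ≠ 0, f (#{j | x j ≠ 0}) =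
      ∑ w ∈ Icc 1 N, (N.choose w : ℝ) * ((Fintype.card F : ℝ) - 1) ^ w * f w := by
  have hfiber : ∀ S : Finset (Fin N),
      (#{x : Fin N → F | ({j | x j ≠ 0} : Finset (Fin N)) = S} : ℝ) =
        ((Fintype.card F : ℝ) - 1) ^ #S := by
    intro S
    have hpi : ({x : Fin N → F | ({j | x j ≠ 0} : Finset (Fin N)) = S} : Finset (Fin N → F)) =
        Fintype.piFinset fun j => if j ∈ S then univ.erase 0 else {0} := by
      ext x
      simp only [mem_filter, mem_univ, true_and, Fintype.mem_piFinset, Finset.ext_iff]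
      refine forall_congr' fun j => ?_
      by_cases hj : j ∈ S <;> simp [hj]
    rw [hpi, Fintype.card_piFinset]
    have hcard : ((Fintype.card F - 1 : ℕ) : ℝ) = (Fintype.card F : ℝ) - 1 :=
      Nat.cast_pred Fintype.card_pos
    simp [apply_ite, card_erase_of_mem, ← hcard]
  have hall : ∀ g : ℕ → ℝ, ∑ x : Fin N → F, g (#{j | x j ≠ 0}) =
      ∑ w ∈ range (N + 1), (N.choose w : ℝ) * ((Fintype.card F : ℝ) - 1) ^ w * g w := by
    intro g
    rw [← sum_fiberwise univ fun x : Fin N → F => ({j | x j ≠ 0} : Finset (Fin N))]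
    have hinner : ∀ S : Finset (Fin N),
        ∑ x : Fin N → F with ({j | x j ≠ 0} : Finset (Fin N)) = S, g (#{j | x j ≠ 0}) =
          ((Fintype.card F : ℝ) - 1) ^ #S * g #S := by
      intro S
      rw [← hfiber S, ← nsmul_eq_mul, ← sum_const]
      exact sum_congr rfl fun x hx => by rw [(mem_filter.1 hx).2]
    rw [sum_congr rfl fun S _ => hinner S, ← powerset_univ,
      sum_powerset_apply_card fun w => ((Fintype.card F : ℝ) - 1) ^ w * g w]
    simp [mul_assoc]
  have hzero : ∀ x : Fin N → F, x = 0 ↔ #{j | x j ≠ 0} = 0 := fun x => by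
    simp [funext_iff, filter_eq_empty_iff]
  rw [sum_filter]
  have hsupp : ∀ x : Fin N → F, (if x ≠ 0 then f (#{j | x j ≠ 0}) else 0) =
      (fun w => if w ≠ 0 then f w else 0) (#{j | x j ≠ 0}) := fun x => by
    simp only [ne_eq, hzero x]
  rw [sum_congr rfl fun x _ => hsupp x]
  refine (hall fun w => if w ≠ 0 then f w else 0).trans ?_
  rw [range_eq_Ico, sum_eq_sum_Ico_succ_bot (by omega)]
  simp only [ne_eq, not_true, if_false, mul_zero, zero_add]
  refine sum_congr (by ext; simp) fun w hw => ?_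
  rw [if_pos (by have := (mem_Icc.1 hw).1; omega)]

lemma card_sub_one_le_card_mulVec_eq_zero {M N : ℕ} (A : Matrix (Fin M) (Fin N) F)
    (hA : A.rank < N) :
    (Fintype.card F : ℝ) - 1 ≤ #{x : Fin N → F | x ≠ 0 ∧ A.mulVec x = 0} := by
  have hker : LinearMap.ker A.mulVecLin ≠ ⊥ := by
    intro h
    have := LinearMap.finrank_range_of_inj (LinearMap.ker_eq_bot.1 h)
    rw [Module.finrank_fin_fun] at this
    exact hA.ne this
  obtain ⟨x, hx, hx0⟩ := Submodule.exists_mem_ne_zero_of_ne_bot hker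
  have hx' : A.mulVec x = 0 := by simpa using hx
  have hle : #(univ.erase (0 : F)) ≤ #{x : Fin N → F | x ≠ 0 ∧ A.mulVec x = 0} := by
    refine card_le_card_of_injOn (fun c => c • x) (fun c hc => ?_)
      ((smul_left_injective F hx0).injOn)
    have hc0 : c ≠ 0 := by simpa using hc
    simp [hc0, hx0, Matrix.mulVec_smul, hx']
  rw [card_erase_of_mem (mem_univ _), card_univ] at hle
  rw [← Nat.cast_pred Fintype.card_pos]
  exact_mod_cast hle

lemma reMatProb_nonneg {εSR εRD : ℝ} (hεSR : εSR ∈ Set.Icc (0 : ℝ) 1)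
    (hεRD : εRD ∈ Set.Icc (0 : ℝ) 1) {M N : ℕ} (A : Matrix (Fin M) (Fin N) F) :
    0 ≤ reMatProb F εSR εRD A := by
  have h := one_lt_card_real (F := F)
  refine prod_nonneg fun i _ => add_nonneg ?_ (mul_nonneg (by linarith [hεRD.2])
    (prod_nonneg fun j _ => ?_))
  · split_ifs
    exacts [hεRD.1, le_rfl]
  · unfold muDist
    split_ifs
    exacts [hεSR.1, div_nonneg (by linarith [hεSR.2]) (by linarith)]

end

/-- Corollary, eq. (6): for a random `M × N` matrix `A` over `F_q`
drawn from the row-erasure model, with `M ≥ N ≥ 1`, the probability of decoding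
failure `P_fail := Pr(rank(A) < N)` satisfies
`P_fail ≤ (1/(q-1))·Σ_{w=1}^{N} C(N,w)·(q-1)^w·[ε_RD + (1-ε_RD)·γ_w]^M`. -/
theorem stmt_7 (F : Type*) [Field F] [Fintype F] [DecidableEq F]
    (hq : 2 ≤ Fintype.card F)
    (εSR : ℝ) (hεSR : εSR ∈ Set.Icc (0 : ℝ) 1)
    (εRD : ℝ) (hεRD : εRD ∈ Set.Icc (0 : ℝ) 1)
    (M N : ℕ) (hN : 1 ≤ N) (hMN : N ≤ M) :
    (∑ A : Matrix (Fin M) (Fin N) F,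
        if A.rank < N then reMatProb F εSR εRD A else 0) ≤
      (1 / ((Fintype.card F : ℝ) - 1)) *
        ∑ w ∈ Icc 1 N, (N.choose w : ℝ) * ((Fintype.card F : ℝ) - 1) ^ w *
          (εRD + (1 - εRD) * gammaW (Fintype.card F : ℝ) εSR w) ^ M := by
  have hq1 : (0 : ℝ) < (Fintype.card F : ℝ) - 1 := sub_pos.2 one_lt_card_real
  rw [one_div, ← div_eq_inv_mul, le_div_iff₀ hq1, ← sum_ne_zero_weight (F := F)
    fun w => (εRD + (1 - εRD) * gammaW (Fintype.card F : ℝ) εSR w) ^ M]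
  simp only [← sum_reMatProb_mulVec_eq_zero]
  rw [sum_comm, sum_mul]
  refine sum_le_sum fun A _ => ?_
  have hA := reMatProb_nonneg hεSR hεRD A
  rw [← mul_sum, sum_boole, filter_filter]
  split_ifs with hr
  · exact mul_le_mul_of_nonneg_left (card_sub_one_le_card_mulVec_eq_zero A hr) hA
  · rw [zero_mul]
    positivity
end
end
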